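/- For every n ≥ 1 and every integer k, the number of Dyck paths of type B_n with area k equals the number of signed permutations σ ∈ NC(B_n) such that the Coxeter length of rev(σ) is k; equivalently, Σ_w q^{area(w)} = Σ_{σ ∈ NC(B_n)} q^{l_S(rev(σ))}, the left sum being over all Dyck paths w of type B_n. -/

import Mathlib

open scoped Classical

namespace Stmt

/-- Number of north steps (`true`) among the first `k` steps of the path `w`. -/
def countN {m : ℕ} (w : Fin m → Bool) (k : ℕ) : ℕ :=
  (Finset.univ.filter (fun t : Fin m => (t : ℕ) < k ∧ w t = true)).card

/-- Number of east steps (`false`) among the first `k` steps of the path `w`. -/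
def countE {m : ℕ} (w : Fin m → Bool) (k : ℕ) : ℕ :=
  (Finset.univ.filter (fun t : Fin m => (t : ℕ) < k ∧ w t = false)).card

/-- A Dyck path of length `n`: `n` north and `n` east steps, every prefix has
at least as many north as east steps. -/
def IsDyckA (n : ℕ) (w : Fin (2 * n) → Bool) : Prop :=
  countN w (2 * n) = n ∧ ∀ k : ℕ, countE w k ≤ countN w k

/-- A Dyck path of type `B_n`: `2n` steps, every prefix has at least as many
north as east steps. -/
def IsDyckB (n : ℕ) (w : Fin (2 * n) → Bool) : Prop :=
  ∀ k : ℕ, countE w k ≤ countN w k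

/-- The unit cell `[i-1,i] × [j-1,j]` lies below the lattice path `w`:
at some time the path has `x`-coordinate `< i` and `y`-coordinate `≥ j`. -/
def CellBelow {m : ℕ} (w : Fin m → Bool) (i j : ℕ) : Prop :=
  ∃ k : ℕ, countE w k < i ∧ j ≤ countN w k

/-- Area of a (type `A`) Dyck path: number of cells `b_{i,j}` with `i < j`
lying below the path. -/
noncomputable def areaA {m : ℕ} (w : Fin m → Bool) : ℕ :=
  {p : ℕ × ℕ | 1 ≤ p.1 ∧ p.1 < p.2 ∧ CellBelow w p.1 p.2}.ncard

/-- Area of a type `B_n` Dyck path: number of cells `b_{i,j}` with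
`1 ≤ i < j ≤ 2n+1-i` lying below the path. -/
noncomputable def areaB (n : ℕ) (w : Fin (2 * n) → Bool) : ℕ :=
  {p : ℕ × ℕ | 1 ≤ p.1 ∧ p.1 < p.2 ∧ p.2 ≤ 2 * n + 1 - p.1 ∧
    CellBelow w p.1 p.2}.ncard

/-- Descent set of a path, 1-indexed: positions `i` with `w_i = E`, `w_{i+1} = N`. -/
def pathDes {m : ℕ} (w : Fin m → Bool) : Finset ℕ :=
  (Finset.Ioo 0 m).filter (fun i =>
    ∃ h : i < m, w ⟨i - 1, Nat.lt_of_le_of_lt (Nat.sub_le i 1) h⟩ = false ∧ w ⟨i, h⟩ = true)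

def desPath {m : ℕ} (w : Fin m → Bool) : ℕ := (pathDes w).card

/-- Major index of a Dyck path of length `n`: `maj(w) = ∑_{i ∈ Des(w)} (2n - i)`. -/
def majA (n : ℕ) (w : Fin (2 * n) → Bool) : ℕ :=
  ∑ i ∈ pathDes w, (2 * n - i)

/-- Number of east steps of a path. -/
def negPath {m : ℕ} (w : Fin m → Bool) : ℕ :=
  (Finset.univ.filter (fun t : Fin m => w t = false)).card

/-- Type `B` major index: `maj(w) = 2 ⬝ (neg(w) + ∑_{i ∈ Des(w)} (2n - i))`. -/
def majB (n : ℕ) (w : Fin (2 * n) → Bool) : ℕ :=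
  2 * (negPath w + ∑ i ∈ pathDes w, (2 * n - i))

/-- A signed permutation of rank `n`, encoded as a permutation of `ℤ` that is
odd (`σ(-x) = -σ(x)`) and fixes every point outside `{±1,…,±n}`. -/
def IsSignedPerm (n : ℕ) (σ : Equiv.Perm ℤ) : Prop :=
  (∀ x : ℤ, σ (-x) = -σ x) ∧ ∀ x : ℤ, ¬(1 ≤ |x| ∧ |x| ≤ (n : ℤ)) → σ x = x

/-- `x` belongs to the ground set `{±1,…,±n}`. -/
def InB (n : ℕ) (x : ℤ) : Prop := 1 ≤ |x| ∧ |x| ≤ (n : ℤ)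

/-- Position of `x` in the total order `-1 < -2 < ⋯ < -n < 1 < 2 < ⋯ < n`. -/
def bKey (n : ℕ) (x : ℤ) : ℤ := if x < 0 then -x else x + (n : ℤ)

/-- `σ` maps each element of every orbit to the cyclically next element of
that orbit with respect to the order `-1 < -2 < ⋯ < -n < 1 < ⋯ < n`. -/
def IncCyclesB (n : ℕ) (σ : Equiv.Perm ℤ) : Prop :=
  ∀ x : ℤ, InB n x →
    ((∃ y, σ.SameCycle x y ∧ bKey n x < bKey n y) →
      bKey n x < bKey n (σ x) ∧
        ∀ y, σ.SameCycle x y → bKey n x < bKey n y → bKey n (σ x) ≤ bKey n y) ∧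
    ((∀ y, σ.SameCycle x y → bKey n y ≤ bKey n x) →
      ∀ y, σ.SameCycle x y → bKey n (σ x) ≤ bKey n y)

/-- No two distinct orbits of `σ` cross, with respect to the order
`-1 < -2 < ⋯ < -n < 1 < ⋯ < n`. -/
def NoCrossingB (n : ℕ) (σ : Equiv.Perm ℤ) : Prop :=
  ¬ ∃ a b c d : ℤ, InB n a ∧ InB n b ∧ InB n c ∧ InB n d ∧
      bKey n a < bKey n b ∧ bKey n b < bKey n c ∧ bKey n c < bKey n d ∧
      σ.SameCycle a c ∧ σ.SameCycle b d ∧ ¬σ.SameCycle a b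

/-- At most one orbit `B` satisfies `B = -B`. -/
def AtMostOneSym (n : ℕ) (σ : Equiv.Perm ℤ) : Prop :=
  ∀ x y : ℤ, InB n x → InB n y → σ.SameCycle x (-x) → σ.SameCycle y (-y) →
    σ.SameCycle x y

/-- Non-crossing "partitions" of type `B_n`, as signed permutations whose orbits
form a non-crossing type `B_n` set partition, each element being mapped to the
cyclically next element of its orbit. -/
def IsNCB (n : ℕ) (σ : Equiv.Perm ℤ) : Prop :=
  IsSignedPerm n σ ∧ IncCyclesB n σ ∧ NoCrossingB n σ ∧ AtMostOneSym n σ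

/-- One-line notation `(σ(1),…,σ(n))` of a signed permutation. -/
def word (n : ℕ) (σ : Equiv.Perm ℤ) : Fin n → ℤ := fun i => σ ((i : ℤ) + 1)

/-- Positions of the negative entries of an integer word. -/
def negSetW {n : ℕ} (f : Fin n → ℤ) : Finset (Fin n) :=
  Finset.univ.filter (fun i => f i < 0)

/-- Number of inversions of an integer word. -/
def invW {n : ℕ} (f : Fin n → ℤ) : ℕ :=
  (Finset.univ.filter (fun p : Fin n × Fin n => p.1 < p.2 ∧ f p.2 < f p.1)).card

/-- Coxeter length of a signed permutation with one-line notation `f`: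
`l_S = inv(f) - ∑_{i ∈ Neg(f)} f i`. -/
def lSW {n : ℕ} (f : Fin n → ℤ) : ℤ :=
  (invW f : ℤ) - ∑ i ∈ negSetW f, f i

/-- Major index of an integer word: sum of the (1-indexed) descent positions. -/
def majW {n : ℕ} (f : Fin n → ℤ) : ℕ :=
  ∑ i ∈ Finset.univ.filter
      (fun i : Fin n => ∃ h : (i : ℕ) + 1 < n, f ⟨(i : ℕ) + 1, h⟩ < f i),
    ((i : ℕ) + 1)

/-- Type `B` major index of a signed permutation with one-line notation `f`:
`maj_B = 2 ⬝ maj(f) + neg(f)`. -/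
def majBW {n : ℕ} (f : Fin n → ℤ) : ℕ := 2 * majW f + (negSetW f).card

/-- One-line notation of the inverse of the signed permutation with one-line
notation `f` (the sum picks out the unique matching position). -/
def wInv {n : ℕ} (f : Fin n → ℤ) : Fin n → ℤ :=
  fun j => ∑ i : Fin n,
    if f i = (j : ℤ) + 1 then (i : ℤ) + 1
    else if f i = -((j : ℤ) + 1) then -((i : ℤ) + 1) else 0

/-- `imaj_B` of the signed permutation with one-line notation `f`. -/
def imajBW {n : ℕ} (f : Fin n → ℤ) : ℕ := majBW (wInv f)

/-- One-line notation of `rev σ`: the subsequence of negative entries is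
reversed in place (the sum picks the entry at the mirrored negative position). -/
def revW {n : ℕ} (f : Fin n → ℤ) : Fin n → ℤ :=
  fun i =>
    if 0 ≤ f i then f i
    else
      ∑ j : Fin n,
        if f j < 0 ∧
            (Finset.univ.filter (fun t : Fin n => f t < 0 ∧ t ≤ i)).card =
              (Finset.univ.filter (fun t : Fin n => f t < 0 ∧ j ≤ t)).card
          then f j else 0

theorem inB_iff {n : ℕ} {x : ℤ} :
    InB n x ↔ (1 ≤ x ∧ x ≤ n) ∨ (-(n : ℤ) ≤ x ∧ x ≤ -1) := by
  unfold InB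
  rcases abs_cases x with h | h <;> omega

theorem inB_neg {n : ℕ} {x : ℤ} : InB n (-x) ↔ InB n x := by
  unfold InB; rw [abs_neg]

theorem finite_setOf_inB (n : ℕ) : {x : ℤ | InB n x}.Finite :=
  (Set.finite_Icc (-(n : ℤ)) n).subset fun x hx => by
    have := inB_iff.1 hx
    simp only [Set.mem_Icc]; omega

/-- Number of points strictly between `x` and `y` on the circle
`-1 < -2 < ⋯ < -n < 1 < ⋯ < n`, running forward from `x`. -/
def cyc (n : ℕ) (x y : ℤ) : ℤ :=
  if bKey n x < bKey n y then bKey n y - bKey n x - 1 else bKey n y - bKey n x - 1 + 2 * n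

theorem bKey_cases {n : ℕ} {x : ℤ} (hx : InB n x) :
    (x < 0 ∧ -(n : ℤ) ≤ x ∧ bKey n x = -x) ∨ (0 < x ∧ x ≤ n ∧ bKey n x = x + n) := by
  have := inB_iff.1 hx
  unfold bKey
  split_ifs <;> omega

theorem cyc_cases (n : ℕ) (x y : ℤ) :
    (bKey n x < bKey n y ∧ cyc n x y = bKey n y - bKey n x - 1) ∨
      (bKey n y ≤ bKey n x ∧ cyc n x y = bKey n y - bKey n x - 1 + 2 * n) := by
  unfold cyc
  split_ifs <;> omega

theorem cyc_neg {n : ℕ} {x y : ℤ} (hx : InB n x) (hy : InB n y) :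
    cyc n (-x) (-y) = cyc n x y := by
  have h1 := bKey_cases hx
  have h2 := bKey_cases hy
  have h3 := bKey_cases (inB_neg.2 hx)
  have h4 := bKey_cases (inB_neg.2 hy)
  have h5 := cyc_cases n x y
  have h6 := cyc_cases n (-x) (-y)
  omega

theorem cyc_injective {n : ℕ} {x y z : ℤ} (hx : InB n x) (hy : InB n y) (hz : InB n z)
    (h : cyc n x y = cyc n x z) : y = z := by
  have h1 := bKey_cases hx
  have h2 := bKey_cases hy
  have h3 := bKey_cases hz
  have h5 := cyc_cases n x y
  have h6 := cyc_cases n x z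
  omega

theorem mem_of_sameCycle {p : ℤ → Prop} {σ : Equiv.Perm ℤ} (h : ∀ x, p (σ x) ↔ p x) {x y : ℤ}
    (hxy : σ.SameCycle x y) : p x ↔ p y := by
  obtain ⟨i, rfl⟩ := hxy
  induction i with
  | zero => simp
  | succ i ih => rw [ih, add_comm, zpow_add, zpow_one, Equiv.Perm.mul_apply, h]
  | pred i ih =>
    rw [ih, ← h ((σ ^ (-(i : ℤ) - 1)) x), ← Equiv.Perm.mul_apply, ← zpow_one_add]
    simp

theorem exists_perm_of_rel (n : ℕ) (r : ℤ → ℤ → Prop)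
    (hin : ∀ x y, r x y → InB n x ∧ InB n y) (hrefl : ∀ x, InB n x → r x x)
    (hsymm : ∀ x y, r x y → r y x) (htrans : ∀ x y z, r x y → r y z → r x z)
    (hneg : ∀ x y, r x y → r (-x) (-y)) :
    ∃ σ : Equiv.Perm ℤ, IsSignedPerm n σ ∧ IncCyclesB n σ ∧
      ∀ x y, InB n x → (σ.SameCycle x y ↔ r x y) := by
  have hex : ∀ x, ∃ y, (InB n x → r x y ∧ ∀ z, r x z → cyc n x y ≤ cyc n x z) ∧
      (¬InB n x → y = x) := by
    intro x
    by_cases hx : InB n x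
    · obtain ⟨y, hy, hmin⟩ := Set.exists_min_image {y | r x y} (cyc n x)
        ((finite_setOf_inB n).subset fun y hy => (hin x y hy).2) ⟨x, hrefl x hx⟩
      exact ⟨y, fun _ => ⟨hy, hmin⟩, fun h => absurd hx h⟩
    · exact ⟨x, fun h => absurd h hx, fun _ => rfl⟩
  choose s hs hs' using hex
  have hsB : ∀ x, InB n x → InB n (s x) := fun x hx => (hin _ _ (hs x hx).1).2
  have hsB' : ∀ x, InB n (s x) ↔ InB n x := by
    intro x
    by_cases hx : InB n x
    · simp [hx, hsB]
    · simp [hx, hs' x hx]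
  have hinj : Function.Injective s := by
    intro x y hxy
    by_cases hx : InB n x
    · have hy : InB n y := by rw [← hsB', ← hxy, hsB']; exact hx
      have hrxy : r x y := htrans _ _ _ (hs x hx).1 (hsymm _ _ (hxy ▸ (hs y hy).1))
      have h1 := (hs x hx).2 y hrxy
      have h2 := (hs y hy).2 x (hsymm _ _ hrxy)
      rw [← hxy] at h2
      have h3 := cyc_cases n x (s x)
      have h4 := cyc_cases n x y
      have h5 := cyc_cases n y (s x)
      have h6 := cyc_cases n y x
      have h7 := bKey_cases hx
      have h8 := bKey_cases hy
      have h9 := bKey_cases (hsB x hx)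
      omega
    · have hy : ¬InB n y := by rw [← hsB', ← hxy, hsB']; exact hx
      rw [← hs' x hx, hxy, hs' y hy]
  have hsurj : Function.Surjective s := by
    intro y
    by_cases hy : InB n y
    · have := (finite_setOf_inB n).toFinset.surjOn_of_injOn_of_card_le
        (t := (finite_setOf_inB n).toFinset) s (fun x hx => by
          simp only [Set.Finite.coe_toFinset, Set.mem_ofPred_eq] at hx ⊢; exact hsB x hx)
        hinj.injOn le_rfl
      obtain ⟨x, -, hx⟩ := this (a := y) (by simpa using hy)
      exact ⟨x, hx⟩
    · exact ⟨y, hs' y hy⟩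
  let σ : Equiv.Perm ℤ := Equiv.ofBijective s ⟨hinj, hsurj⟩
  have hσ : ∀ x, σ x = s x := fun x => rfl
  have hto : ∀ x y, σ.SameCycle x y → InB n x → r x y := by
    intro x y hxy hx
    refine (mem_of_sameCycle (p := r x) (fun z => ?_) hxy).1 (hrefl x hx)
    rw [hσ]
    constructor
    · intro h
      have hz : InB n z := (hsB' z).1 (hin _ _ h).2
      exact htrans _ _ _ h (hsymm _ _ (hs z hz).1)
    · intro h
      exact htrans _ _ _ h (hs z (hin _ _ h).2).1
  have hfrom : ∀ d : ℕ, ∀ x y, r x y → cyc n x y < d → σ.SameCycle x y := by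
    intro d
    induction d with
    | zero =>
      intro x y hxy hlt
      have h4 := cyc_cases n x y
      have h7 := bKey_cases (hin _ _ hxy).1
      have h8 := bKey_cases (hin _ _ hxy).2
      omega
    | succ d ih =>
      intro x y hxy hlt
      have hx := (hin _ _ hxy).1
      have hxs : σ.SameCycle x (s x) := ⟨1, by simp [hσ]⟩
      by_cases hy : s x = y
      · rwa [← hy]
      · refine hxs.trans (ih _ _ (htrans _ _ _ (hsymm _ _ (hs x hx).1) hxy) ?_)
        have h1 := (hs x hx).2 y hxy
        have h3 := cyc_cases n x (s x)
        have h4 := cyc_cases n x y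
        have h5 := cyc_cases n (s x) y
        have h7 := bKey_cases hx
        have h8 := bKey_cases (hin _ _ hxy).2
        have h9 := bKey_cases (hsB x hx)
        push_cast at hlt
        omega
  have hiff : ∀ x y, InB n x → (σ.SameCycle x y ↔ r x y) := fun x y hx =>
    ⟨fun h => hto x y h hx, fun h => hfrom (cyc n x y).toNat.succ x y h (by omega)⟩
  refine ⟨σ, ⟨fun x => ?_, fun x hx => hs' x hx⟩, fun x hx => ⟨?_, ?_⟩, hiff⟩
  · rw [hσ, hσ]
    by_cases hx : InB n x
    · have hx' := inB_neg.2 hx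
      refine cyc_injective hx' (hsB _ hx') (inB_neg.2 (hsB _ hx)) (le_antisymm ?_ ?_)
      · exact (hs _ hx').2 _ (hneg _ _ (hs x hx).1)
      · rw [cyc_neg hx (hsB x hx)]
        have h := hneg _ _ (hs _ hx').1
        rw [neg_neg] at h
        have := (hs x hx).2 _ h
        rwa [← cyc_neg hx (hin _ _ h).2, neg_neg] at this
    · rw [hs' x hx, hs' _ (mt inB_neg.1 hx)]
  · rintro ⟨y, hxy, hlt⟩
    rw [hiff x y hx] at hxy
    rw [hσ]
    have h1 := (hs x hx).2 y hxy
    have h3 := cyc_cases n x (s x)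
    have h4 := cyc_cases n x y
    have h7 := bKey_cases hx
    have h8 := bKey_cases (hin _ _ hxy).2
    have h9 := bKey_cases (hsB x hx)
    refine ⟨by omega, fun z hz hlt' => ?_⟩
    rw [hiff x z hx] at hz
    have h1 := (hs x hx).2 z hz
    have h4 := cyc_cases n x z
    have h8 := bKey_cases (hin _ _ hz).2
    omega
  · intro hmax y hxy
    have hsx := hmax (s x) (hfrom (cyc n x (s x)).toNat.succ _ _ (hs x hx).1 (by omega))
    have hyx := hmax y hxy
    rw [hiff x y hx] at hxy
    rw [hσ]
    have h1 := (hs x hx).2 y hxy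
    have h3 := cyc_cases n x (s x)
    have h4 := cyc_cases n x y
    omega

theorem card_left_add_card_right {n : ℕ} (f : Fin n → ℤ) {i : Fin n} (hi : f i < 0) :
    (Finset.univ.filter (fun t : Fin n => f t < 0 ∧ t ≤ i)).card +
      (Finset.univ.filter (fun t : Fin n => f t < 0 ∧ i ≤ t)).card = (negSetW f).card + 1 := by
  rw [← Finset.card_union_add_card_inter]
  congr 1
  · congr 1
    ext t
    simp only [negSetW, Finset.mem_union, Finset.mem_filter, Finset.mem_univ, true_and]
    have := le_total t i
    tauto
  · rw [Finset.card_eq_one]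
    refine ⟨i, ?_⟩
    ext t
    simp only [Finset.mem_inter, Finset.mem_filter, Finset.mem_univ, true_and,
      Finset.mem_singleton]
    constructor
    · rintro ⟨⟨-, h1⟩, -, h2⟩
      exact le_antisymm h1 h2
    · rintro rfl
      exact ⟨⟨hi, le_rfl⟩, hi, le_rfl⟩

theorem card_right_lt {n : ℕ} (f : Fin n → ℤ) {i j : Fin n} (hi : f i < 0) (hij : i < j) :
    (Finset.univ.filter (fun t : Fin n => f t < 0 ∧ j ≤ t)).card <
      (Finset.univ.filter (fun t : Fin n => f t < 0 ∧ i ≤ t)).card := by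
  refine Finset.card_lt_card (Finset.ssubset_iff_of_subset (fun t ht => ?_) |>.2 ⟨i, ?_, ?_⟩)
  · simp only [Finset.mem_filter, Finset.mem_univ, true_and] at ht ⊢
    exact ⟨ht.1, hij.le.trans ht.2⟩
  · simp [hi]
  · simp [hij]

/-- `revW f` is `f` composed with the reflection `ρ` of the positions of its negative entries. -/
theorem exists_mirror {n : ℕ} (f : Fin n → ℤ) :
    ∃ ρ : Fin n → Fin n, (∀ i, f i < 0 → f (ρ i) < 0 ∧ revW f i = f (ρ i)) ∧
      (∀ i j, f i < 0 → f j < 0 → i < j → ρ j < ρ i) := by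
  set b : Fin n → ℕ := fun j =>
    (Finset.univ.filter (fun t : Fin n => f t < 0 ∧ j ≤ t)).card with hb
  have hanti : ∀ i j, f i < 0 → i < j → b j < b i := fun i j hi hij => card_right_lt f hi hij
  have hinj : Set.InjOn b (negSetW f) := by
    intro i hi j hj hij
    simp only [negSetW, Finset.coe_filter, Finset.mem_univ, true_and, Set.mem_ofPred_eq] at hi hj
    rcases lt_trichotomy i j with h | h | h
    · have := hanti i j hi h; omega
    · exact h
    · have := hanti j i hj h; omega
  have hb1 : ∀ i, f i < 0 → 1 ≤ b i := fun i hi => Finset.card_pos.2 ⟨i, by simp [hi]⟩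
  have hb2 : ∀ i, b i ≤ (negSetW f).card := fun i => Finset.card_le_card fun t ht => by
    simp only [negSetW, Finset.mem_filter, Finset.mem_univ, true_and] at ht ⊢; exact ht.1
  have hsurj : Set.SurjOn b (negSetW f) (Finset.Icc 1 (negSetW f).card) := by
    refine Finset.surjOn_of_injOn_of_card_le b (fun i hi => ?_) hinj (by simp)
    simp only [negSetW, Finset.coe_filter, Finset.mem_univ, true_and, Set.mem_ofPred_eq] at hi
    simp only [Finset.coe_Icc, Set.mem_Icc]
    exact ⟨hb1 i hi, hb2 i⟩
  have hex : ∀ i, ∃ j, f i < 0 → f j < 0 ∧ b i + b j = (negSetW f).card + 1 := by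
    intro i
    by_cases hi : f i < 0
    · have h1 := hb1 i hi
      have h2 := hb2 i
      obtain ⟨j, hj, hj'⟩ := hsurj (a := (negSetW f).card + 1 - b i) (by
        simp only [Finset.coe_Icc, Set.mem_Icc]; omega)
      simp only [negSetW, Finset.coe_filter, Finset.mem_univ, true_and, Set.mem_ofPred_eq] at hj
      exact ⟨j, fun _ => ⟨hj, by omega⟩⟩
    · exact ⟨i, fun h => absurd h hi⟩
  choose ρ hρ using hex
  refine ⟨ρ, fun i hi => ⟨(hρ i hi).1, ?_⟩, fun i j hi hj hij => ?_⟩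
  · have hcond : ∀ j, (f j < 0 ∧ (Finset.univ.filter (fun t : Fin n => f t < 0 ∧ t ≤ i)).card =
        (Finset.univ.filter (fun t : Fin n => f t < 0 ∧ j ≤ t)).card) ↔ j = ρ i := by
      intro j
      have h1 : _ + b i = _ := card_left_add_card_right f hi
      have h2 := (hρ i hi).2
      constructor
      · rintro ⟨hj, h⟩
        refine hinj (by simpa [negSetW] using hj) (by simpa [negSetW] using (hρ i hi).1) ?_
        simp only [hb] at h1 h2 ⊢
        omega
      · rintro rfl
        refine ⟨(hρ i hi).1, ?_⟩
        simp only [hb] at h1 h2 ⊢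
        omega
    unfold revW
    rw [if_neg (not_le.2 hi)]
    simp only [hcond]
    simp
  · have h1 := (hρ i hi).2
    have h2 := (hρ j hj).2
    have h3 := hanti i j hi hij
    rcases lt_trichotomy (ρ i) (ρ j) with h | h | h
    · have := hanti _ _ (hρ i hi).1 h; omega
    · rw [h] at h1; omega
    · exact h

theorem revW_of_nonneg {n : ℕ} {f : Fin n → ℤ} {i : Fin n} (h : 0 ≤ f i) : revW f i = f i := by
  unfold revW; rw [if_pos h]

theorem revW_neg_iff {n : ℕ} {f : Fin n → ℤ} {i : Fin n} : revW f i < 0 ↔ f i < 0 := by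
  obtain ⟨ρ, hρ, -⟩ := exists_mirror f
  by_cases h : f i < 0
  · rw [(hρ i h).2]; exact iff_of_true (hρ i h).1 h
  · rw [revW_of_nonneg (not_lt.1 h)]

theorem revW_lt_revW {n : ℕ} {f : Fin n → ℤ}
    (hf : ∀ i j, f i < 0 → f j < 0 → i < j → f i < f j) {i j : Fin n}
    (hi : f i < 0) (hj : f j < 0) (hij : i < j) : revW f j < revW f i := by
  obtain ⟨ρ, hρ, hanti⟩ := exists_mirror f
  rw [(hρ i hi).2, (hρ j hj).2]
  exact hf _ _ (hρ j hj).1 (hρ i hi).1 (hanti i j hi hj hij)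

theorem sum_negSetW_revW {n : ℕ} (f : Fin n → ℤ) :
    ∑ i ∈ negSetW (revW f), revW f i = ∑ i ∈ negSetW f, f i := by
  obtain ⟨ρ, hρ, hanti⟩ := exists_mirror f
  have hneg : negSetW (revW f) = negSetW f := by
    ext i; simp [negSetW, revW_neg_iff]
  have hinj : Set.InjOn ρ (negSetW f) := by
    intro i hi j hj hij
    simp only [negSetW, Finset.coe_filter, Finset.mem_univ, true_and, Set.mem_ofPred_eq] at hi hj
    rcases lt_trichotomy i j with h | h | h
    · exact absurd hij (hanti i j hi hj h).ne'
    · exact h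
    · exact absurd hij (hanti j i hj hi h).ne
  have hmaps : ∀ i ∈ negSetW f, ρ i ∈ negSetW f := fun i hi => by
    simp only [negSetW, Finset.mem_filter, Finset.mem_univ, true_and] at hi ⊢
    exact (hρ i hi).1
  have hsurj := Finset.surjOn_of_injOn_of_card_le ρ hmaps hinj le_rfl
  rw [hneg]
  refine Finset.sum_bij (fun i _ => ρ i) hmaps (fun i hi j hj h => hinj hi hj h)
    (fun j hj => ?_) (fun i hi => ?_)
  · obtain ⟨i, hi, hij⟩ := hsurj hj
    exact ⟨i, hi, hij⟩
  · simp only [negSetW, Finset.mem_filter, Finset.mem_univ, true_and] at hi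
    exact (hρ i hi).2

namespace IsSignedPerm

variable {n : ℕ} {σ : Equiv.Perm ℤ}

theorem inB_apply (h : IsSignedPerm n σ) {x : ℤ} : InB n (σ x) ↔ InB n x := by
  by_cases hx : InB n x
  · refine iff_of_true (by_contra fun hs => hs ?_) hx
    have := h.2 (σ x) hs
    rwa [σ.injective this]
  · rw [h.2 x hx]

theorem inB_symm_apply (h : IsSignedPerm n σ) {x : ℤ} : InB n (σ.symm x) ↔ InB n x := by
  rw [← h.inB_apply, Equiv.apply_symm_apply]

theorem inB_of_sameCycle (h : IsSignedPerm n σ) {x y : ℤ} (hx : InB n x)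
    (hxy : σ.SameCycle x y) : InB n y :=
  (mem_of_sameCycle (p := InB n) (fun _ => h.inB_apply) hxy).1 hx

theorem symm_neg (h : IsSignedPerm n σ) (x : ℤ) : σ.symm (-x) = -σ.symm x := by
  rw [Equiv.symm_apply_eq, h.1, Equiv.apply_symm_apply]

end IsSignedPerm

theorem sameCycle_self_apply (σ : Equiv.Perm ℤ) (x : ℤ) : σ.SameCycle x (σ x) :=
  ⟨1, by simp⟩

namespace IsNCB

variable {n : ℕ} {σ : Equiv.Perm ℤ}

theorem not_between (h : IsNCB n σ) {x y : ℤ} (hx : InB n x) (hxy : σ.SameCycle x y)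
    (h1 : bKey n x < bKey n y) (h2 : bKey n y < bKey n (σ x)) : False := by
  have := ((h.2.1 x hx).1 ⟨y, hxy, h1⟩).2 y hxy h1
  omega

theorem isMax (h : IsNCB n σ) {x y : ℤ} (hx : InB n x) (hxy : σ.SameCycle x y)
    (h1 : bKey n (σ x) ≤ bKey n x) : bKey n y ≤ bKey n x := by
  by_contra hlt
  have := ((h.2.1 x hx).1 ⟨y, hxy, by omega⟩).1
  omega

theorem apply_isMin (h : IsNCB n σ) {x y : ℤ} (hx : InB n x) (hxy : σ.SameCycle x y)
    (h1 : bKey n (σ x) ≤ bKey n x) : bKey n (σ x) ≤ bKey n y :=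
  (h.2.1 x hx).2 (fun _ hz => h.isMax hx hz h1) y hxy

theorem isMin (h : IsNCB n σ) {x y : ℤ} (hx : InB n x) (hxy : σ.SameCycle x y)
    (h1 : bKey n x ≤ bKey n (σ.symm x)) : bKey n x ≤ bKey n y := by
  have hs : σ.SameCycle (σ.symm x) x := by
    simpa using sameCycle_self_apply σ (σ.symm x)
  have := h.apply_isMin (h.1.inB_symm_apply.2 hx) (hs.trans hxy) (by simpa using h1)
  simpa using this

theorem sameCycle_of_crossing (h : IsNCB n σ) {a b c d : ℤ} (ha : InB n a) (hb : InB n b)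
    (hac : σ.SameCycle a c) (hbd : σ.SameCycle b d) (h1 : bKey n a < bKey n b)
    (h2 : bKey n b < bKey n c) (h3 : bKey n c < bKey n d) : σ.SameCycle a b := by
  by_contra hab
  exact h.2.2.1 ⟨a, b, c, d, ha, hb, h.1.inB_of_sameCycle ha hac, h.1.inB_of_sameCycle hb hbd,
    h1, h2, h3, hac, hbd, hab⟩

theorem apply_lt_apply_of_neg (h : IsNCB n σ) {i j : ℤ} (hi : 0 < i) (hij : i < j) (hj : j ≤ n)
    (hsi : σ i < 0) (hsj : σ j < 0) : σ i < σ j := by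
  have hiB : InB n i := inB_iff.2 (by omega)
  have hjB : InB n j := inB_iff.2 (by omega)
  have k1 := bKey_cases hiB
  have k2 := bKey_cases hjB
  have k3 := bKey_cases (h.1.inB_apply.2 hiB)
  have k4 := bKey_cases (h.1.inB_apply.2 hjB)
  by_contra hlt
  have hne : σ i ≠ σ j := fun e => hij.ne (σ.injective e)
  have hc := h.sameCycle_of_crossing (h.1.inB_apply.2 hiB) (h.1.inB_apply.2 hjB)
    (sameCycle_self_apply σ i).symm (sameCycle_self_apply σ j).symm (by omega) (by omega)
    (by omega)
  have := h.isMax hiB (((sameCycle_self_apply σ i).trans hc).trans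
    (sameCycle_self_apply σ j).symm) (by omega)
  omega

/-- If `j` lies under the arc from `i` to `σ i`, then so does `σ j`. -/
theorem lt_apply_of_lt_apply (h : IsNCB n σ) {i j : ℤ} (hi : 0 < i) (hij : i < j) (hj : j ≤ n)
    (hsi : j < σ i) : i < σ j ∧ σ j < σ i := by
  have hiB : InB n i := inB_iff.2 (by omega)
  have hjB : InB n j := inB_iff.2 (by omega)
  have k1 := bKey_cases hiB
  have k2 := bKey_cases hjB
  have k3 := bKey_cases (h.1.inB_apply.2 hiB)
  have k4 := bKey_cases (h.1.inB_apply.2 hjB)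
  have hne : σ i ≠ σ j := fun e => hij.ne (σ.injective e)
  have hnc : ¬σ.SameCycle i j := fun hc => h.not_between hiB hc (by omega) (by omega)
  have hj' := sameCycle_self_apply σ j
  have hi' := sameCycle_self_apply σ i
  have hne' : σ j ≠ i := by rintro e; rw [e] at hj'; exact hnc hj'.symm
  rcases lt_trichotomy (bKey n (σ j)) (bKey n i) with hlt | heq | hgt
  · exact absurd ((hj'.trans (h.sameCycle_of_crossing (h.1.inB_apply.2 hjB) hiB hj'.symm hi' hlt
      (by omega) (by omega))).symm) hnc
  · omega
  · refine ⟨by omega, ?_⟩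
    by_contra hlt
    exact hnc (h.sameCycle_of_crossing hiB hjB hi' hj' (by omega) (by omega) (by omega))

theorem apply_lt_apply_iff (h : IsNCB n σ) {i j : ℤ} (hi : 0 < i) (hij : i < j) (hj : j ≤ n)
    (hsj : 0 < σ j) : σ j < σ i ↔ j < σ i ∨ σ j ≤ i := by
  have hiB : InB n i := inB_iff.2 (by omega)
  have hjB : InB n j := inB_iff.2 (by omega)
  have k1 := bKey_cases hiB
  have k2 := bKey_cases hjB
  have k3 := bKey_cases (h.1.inB_apply.2 hiB)
  have k4 := bKey_cases (h.1.inB_apply.2 hjB)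
  have hne : σ i ≠ σ j := fun e => hij.ne (σ.injective e)
  have hj' := sameCycle_self_apply σ j
  have hi' := sameCycle_self_apply σ i
  constructor
  · intro hlt
    by_contra hcon
    push Not at hcon
    have hc : σ.SameCycle i (σ j) := by
      rcases hcon.1.lt_or_eq with hlt' | heq
      · exact h.sameCycle_of_crossing hiB (h.1.inB_apply.2 hjB) hi' hj'.symm (by omega) (by omega)
          (by omega)
      · rw [heq] at hi'; exact hi'.trans hj'
    exact h.not_between hiB hc (by omega) (by omega)
  · rintro (hlt | hle)
    · exact (h.lt_apply_of_lt_apply hi hij hj hlt).2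
    · by_contra hlt
      have hc : σ.SameCycle (σ i) (σ j) := by
        rcases hle.lt_or_eq with hlt' | heq
        · exact h.sameCycle_of_crossing (h.1.inB_apply.2 hiB) (h.1.inB_apply.2 hjB) hi'.symm
            hj'.symm (by omega) (by omega) (by omega)
        · rw [heq]; exact hi'.symm
      have := h.apply_isMin hjB (hj'.trans hc.symm) (by omega)
      omega

end IsNCB

theorem card_filter_fin {n : ℕ} (a b : ℕ) (hb : b ≤ n) :
    (Finset.univ.filter (fun t : Fin n => a ≤ (t : ℕ) ∧ (t : ℕ) < b)).card = b - a := by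
  rw [← Nat.card_Ico a b, ← Finset.card_map Fin.valEmbedding]
  congr 1
  ext t
  simp only [Finset.mem_map, Finset.mem_filter, Finset.mem_univ, true_and, Fin.valEmbedding_apply,
    Finset.mem_Ico]
  constructor
  · rintro ⟨s, hs, rfl⟩
    exact hs
  · intro ht
    exact ⟨⟨t, by omega⟩, ht, rfl⟩

theorem word_cases {n : ℕ} {σ : Equiv.Perm ℤ} (h : IsSignedPerm n σ) (i : Fin n) :
    (1 ≤ word n σ i ∧ word n σ i ≤ n) ∨ (-(n : ℤ) ≤ word n σ i ∧ word n σ i ≤ -1) := by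
  have hi := i.2
  exact inB_iff.1 (h.inB_apply.2 (inB_iff.2 (by omega)))

theorem lSW_revW_word {n : ℕ} {σ : Equiv.Perm ℤ} (h : IsNCB n σ) :
    lSW (revW (word n σ)) = ∑ i : Fin n,
      if word n σ i < 0 then (i : ℤ) - word n σ i
      else if word n σ i ≤ (i : ℤ) + 1 then (i : ℤ) + 1 - word n σ i
      else word n σ i - i - 2 := by
  set f := word n σ with hf
  have hfc : ∀ i : Fin n, (1 ≤ f i ∧ f i ≤ n) ∨ (-(n : ℤ) ≤ f i ∧ f i ≤ -1) := word_cases h.1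
  have hinv : ∀ i j : Fin n, (i < j ∧ revW f j < revW f i) ↔
      ((i < j ∧ (j : ℤ) + 1 < f i) ∨ (i < j ∧ f j ≤ (i : ℤ) + 1)) := by
    intro i j
    rw [← and_or_left]
    refine and_congr_right fun hij => ?_
    have hij' : (i : ℤ) < j := by exact_mod_cast hij
    have hjn := j.2
    have hi := hfc i
    have hj := hfc j
    have h1 := h.lt_apply_of_lt_apply (i := (i : ℤ) + 1) (j := (j : ℤ) + 1) (by omega) (by omega)
      (by omega)
    have h2 := h.apply_lt_apply_iff (i := (i : ℤ) + 1) (j := (j : ℤ) + 1) (by omega) (by omega)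
      (by omega)
    change (_ < f i → _ < f j ∧ f j < f i) at h1
    change 0 < f j → (f j < f i ↔ _ < f i ∨ f j ≤ _) at h2
    rcases lt_or_ge (f i) 0 with hi0 | hi0 <;> rcases lt_or_ge (f j) 0 with hj0 | hj0
    · have := revW_lt_revW (f := f) (fun a b ha hb hab => by
        have hab' : (a : ℤ) < b := by exact_mod_cast hab
        have hbn := b.2
        exact h.apply_lt_apply_of_neg (by omega) (by omega) (by omega) ha hb) hi0 hj0 hij
      exact iff_of_true this (by omega)
    · have := revW_neg_iff.2 hi0
      rw [revW_of_nonneg hj0]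
      omega
    · have := revW_neg_iff.2 hj0
      rw [revW_of_nonneg hi0]
      omega
    · rw [revW_of_nonneg hi0, revW_of_nonneg hj0]
      omega
  have hcard : (invW (revW f) : ℤ) =
      ∑ i : Fin n, ((if (i : ℤ) + 1 < f i then f i - i - 2 else 0) +
        if f i < 0 then (i : ℤ) else if f i ≤ (i : ℤ) + 1 then (i : ℤ) + 1 - f i else 0) := by
    unfold invW
    simp only [hinv]
    rw [Finset.filter_or, Finset.card_union_of_disjoint, Finset.sum_add_distrib]
    · push_cast
      congr 1
      · rw [← Finset.univ_product_univ, Finset.card_filter, Finset.sum_product]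
        push_cast
        refine Finset.sum_congr rfl fun i _ => ?_
        have := card_filter_fin (n := n) (i + 1) (f i - 1).toNat (by have := hfc i; omega)
        rw [← Finset.natCast_card_filter]
        trans (((f i - 1).toNat - (i + 1) : ℕ) : ℤ)
        · rw [← this]
          congr 2
          ext t
          simp only [Fin.lt_def, Finset.mem_filter, Finset.mem_univ, true_and]
          omega
        · split_ifs <;> omega
      · rw [← Finset.univ_product_univ, Finset.card_filter, Finset.sum_product_right]
        push_cast
        refine Finset.sum_congr rfl fun j _ => ?_
        have := card_filter_fin (n := n) (f j - 1).toNat j (by omega)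
        rw [← Finset.natCast_card_filter]
        trans ((j - (f j - 1).toNat : ℕ) : ℤ)
        · rw [← this]
          congr 2
          ext t
          simp only [Fin.lt_def, Finset.mem_filter, Finset.mem_univ, true_and]
          omega
        · have := hfc j
          split_ifs <;> omega
    · rw [Finset.disjoint_filter]
      rintro ⟨i, j⟩ - ⟨hij, h1⟩ ⟨-, h2⟩
      have hij' : (i : ℤ) < j := by exact_mod_cast hij
      have hjn := j.2
      have := h.lt_apply_of_lt_apply (i := (i : ℤ) + 1) (j := (j : ℤ) + 1) (by omega) (by omega)
        (by omega) h1
      change _ < f j ∧ _ at this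
      simp only at h2
      omega
  unfold lSW
  rw [hcard, sum_negSetW_revW, negSetW, Finset.sum_filter, ← Finset.sum_sub_distrib]
  refine Finset.sum_congr rfl fun i _ => ?_
  have := hfc i
  split_ifs <;> omega

/-- The lattice path of a signed permutation: reading `x = n, …, 1`, the two letters contributed by
`x` record whether `σ x ≤ x` and whether `σ⁻¹ x < x`. -/
noncomputable def ncPath (n : ℕ) (σ : Equiv.Perm ℤ) : Fin (2 * n) → Bool := fun t =>
  if (t : ℕ) % 2 = 0 then decide (σ (n - (t / 2 : ℕ)) ≤ n - (t / 2 : ℕ))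
  else decide (σ.symm (n - (t / 2 : ℕ)) < n - (t / 2 : ℕ))

theorem ncPath_even {n m : ℕ} (σ : Equiv.Perm ℤ) (h : 2 * m < 2 * n) :
    ncPath n σ ⟨2 * m, h⟩ = decide (σ (n - m) ≤ n - m) := by
  unfold ncPath
  have : 2 * m / 2 = m := by omega
  simp [this]

theorem ncPath_odd {n m : ℕ} (σ : Equiv.Perm ℤ) (h : 2 * m + 1 < 2 * n) :
    ncPath n σ ⟨2 * m + 1, h⟩ = decide (σ.symm (n - m) < n - m) := by
  unfold ncPath
  have : (2 * m + 1) / 2 = m := by omega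
  have h2 : (2 * m + 1) % 2 = 1 := by omega
  simp [this, h2]

/-- `σ` and `τ` have the same positive excedances and the same positive inverse excedances. -/
def SameLetters (n : ℕ) (σ τ : Equiv.Perm ℤ) : Prop :=
  ∀ x : ℤ, 1 ≤ x → x ≤ n → (σ x ≤ x ↔ τ x ≤ x) ∧ (σ.symm x < x ↔ τ.symm x < x)

theorem SameLetters.symm {n : ℕ} {σ τ : Equiv.Perm ℤ} (h : SameLetters n σ τ) :
    SameLetters n τ σ := fun x h1 h2 => ⟨(h x h1 h2).1.symm, (h x h1 h2).2.symm⟩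

theorem sameLetters_of_ncPath_eq {n : ℕ} {σ τ : Equiv.Perm ℤ} (h : ncPath n σ = ncPath n τ) :
    SameLetters n σ τ := by
  intro x h1 h2
  obtain ⟨m, rfl⟩ : ∃ m : ℕ, x = n - m := ⟨(n - x).toNat, by omega⟩
  have he := congrFun h ⟨2 * m, by omega⟩
  have ho := congrFun h ⟨2 * m + 1, by omega⟩
  rw [ncPath_even, ncPath_even] at he
  rw [ncPath_odd, ncPath_odd] at ho
  exact ⟨by simpa using he, by simpa using ho⟩

namespace IsNCB

variable {n : ℕ} {σ τ : Equiv.Perm ℤ}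

theorem not_apply_lt_of_sameLetters (h : IsNCB n σ) (h' : IsNCB n τ) (hL : SameLetters n σ τ)
    {x : ℤ} (hx : 0 < x) (ih : ∀ z, x < z → z ≤ n → z < σ z → σ z = τ z)
    (hxσ : x < σ x) (hlt : σ x < τ x) : False := by
  have hτx : τ x ≤ n := by
    by_contra hcon
    rw [h'.1.2 x (fun hxB => by
      have := inB_iff.1 (h'.1.inB_apply.2 hxB)
      omega)] at hcon
    have := h.1.2 x (fun hxB => by
      have := inB_iff.1 hxB
      omega)
    omega
  have hxB : InB n x := inB_iff.2 (by omega)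
  have hyB := h.1.inB_apply.2 hxB
  have huB := h'.1.inB_symm_apply.2 hyB
  have hu : τ.symm (σ x) < σ x := by
    rw [← (hL (σ x) (by omega) (by omega)).2, Equiv.symm_apply_apply]
    exact hxσ
  have huy : τ.SameCycle (τ.symm (σ x)) (σ x) := by
    simpa using sameCycle_self_apply τ (τ.symm (σ x))
  have hxy := sameCycle_self_apply τ x
  have k1 := bKey_cases hxB
  have k2 := bKey_cases hyB
  have k3 := bKey_cases huB
  have k4 := bKey_cases (h'.1.inB_apply.2 hxB)
  have hnc : ¬τ.SameCycle x (σ x) := fun hc => h'.not_between hxB hc (by omega) (by omega)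
  have hxu : bKey n x < bKey n (τ.symm (σ x)) := by
    rcases lt_trichotomy (bKey n x) (bKey n (τ.symm (σ x))) with hc | hc | hc
    · exact hc
    · have : x = τ.symm (σ x) := by omega
      rw [← this] at huy
      exact absurd huy hnc
    · exact absurd ((h'.sameCycle_of_crossing huB hxB huy hxy hc (by omega) (by omega)).symm.trans
        huy) hnc
  have hus : τ.symm (σ x) < σ (τ.symm (σ x)) := by
    by_contra hcon
    have := (hL (τ.symm (σ x)) (by omega) (by omega)).1.1 (by omega)
    rw [Equiv.apply_symm_apply] at this
    omega
  have heq := ih _ (by omega) (by omega) hus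
  rw [Equiv.apply_symm_apply] at heq
  have := σ.injective heq
  omega

theorem apply_eq_of_lt_apply (h : IsNCB n σ) (h' : IsNCB n τ) (hL : SameLetters n σ τ) :
    ∀ d : ℕ, ∀ x : ℤ, 0 < x → x ≤ n → n - x ≤ d → x < σ x → σ x = τ x := by
  intro d
  induction d using Nat.strong_induction_on with
  | _ d ih =>
    intro x hx hxn hd hxσ
    have hxτ : x < τ x := by
      have := (hL x (by omega) hxn).1
      omega
    have ih1 : ∀ z, x < z → z ≤ n → z < σ z → σ z = τ z := fun z hz hzn hzσ =>
      ih (n - z).toNat (by omega) z (by omega) hzn (by omega) hzσ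
    rcases lt_trichotomy (σ x) (τ x) with hlt | heq | hgt
    · exact (h.not_apply_lt_of_sameLetters h' hL hx ih1 hxσ hlt).elim
    · exact heq
    · refine (h'.not_apply_lt_of_sameLetters h hL.symm hx (fun z hz hzn hzτ => ?_) hxτ hgt).elim
      exact (ih1 z hz hzn (by have := (hL z (by omega) hzn).1; omega)).symm

theorem apply_eq_of_pos_of_le (h : IsNCB n σ) (h' : IsNCB n τ) (hL : SameLetters n σ τ)
    {x : ℤ} (hxn : x ≤ n) (hpos : 0 < σ x) (hle : σ x ≤ x) : σ x = τ x := by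
  have hxB : InB n x := inB_iff.2 (by omega)
  have hmB := h.1.inB_apply.2 hxB
  have hτB := h'.1.inB_apply.2 hxB
  have k1 := bKey_cases hxB
  have k2 := bKey_cases hmB
  have k3 := bKey_cases hτB
  have key : ∀ d : ℕ, ∀ z : ℤ, σ.SameCycle z x → σ x ≤ z → x - z ≤ d → τ.SameCycle z x := by
    intro d
    induction d with
    | zero =>
      intro z hz hxz hd
      have hzB := h.1.inB_of_sameCycle hxB hz.symm
      have k4 := bKey_cases hzB
      have := h.isMax hxB hz.symm (by omega)
      have : z = x := by omega
      rw [this]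
    | succ d ih =>
      intro z hz hxz hd
      have hzB := h.1.inB_of_sameCycle hxB hz.symm
      have hσzB := h.1.inB_apply.2 hzB
      have k4 := bKey_cases hzB
      have k5 := bKey_cases hσzB
      by_cases hzx : z = x
      · rw [hzx]
      · have h1 := h.isMax hxB hz.symm (by omega)
        have h2 : bKey n z < bKey n (σ z) := by
          by_contra hcon
          have := h.isMax hzB hz (by omega)
          omega
        have h3 := h.apply_eq_of_lt_apply h' hL (n - z).toNat z (by omega) (by omega) (by omega)
          (by omega)
        have h4 := ih (σ z) ((sameCycle_self_apply σ z).symm.trans hz) (by omega)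
          (by push_cast at hd; omega)
        rw [h3] at h4
        exact (sameCycle_self_apply τ z).trans h4
  have hmx : τ.SameCycle (σ x) x :=
    key (x - σ x).toNat (σ x) (sameCycle_self_apply σ x).symm le_rfl (by omega)
  have hτx := (hL x (by omega) hxn).1.1 hle
  have h1 := h'.apply_isMin hxB hmx.symm (by omega)
  have hsB := h'.1.inB_symm_apply.2 hmB
  have k6 := bKey_cases hsB
  have h2 := (hL (σ x) (by omega) (by omega)).2
  rw [Equiv.symm_apply_apply] at h2
  have h3 := h'.isMin hmB (hmx.trans (sameCycle_self_apply τ x)) (by omega)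
  omega

theorem apply_eq_of_apply_pos (h : IsNCB n σ) (h' : IsNCB n τ) (hL : SameLetters n σ τ)
    {x : ℤ} (hx : 0 < x) (hxn : x ≤ n) (hpos : 0 < σ x) : σ x = τ x := by
  rcases le_or_gt (σ x) x with hle | hlt
  · exact h.apply_eq_of_pos_of_le h' hL hxn hpos hle
  · exact h.apply_eq_of_lt_apply h' hL (n - x).toNat x hx hxn (by omega) hlt

theorem not_apply_lt_of_apply_neg (h : IsNCB n σ) (h' : IsNCB n τ) (hL : SameLetters n σ τ)
    {x : ℤ} (hx : 0 < x) (hxn : x ≤ n) (ih : ∀ z, 0 < z → z < x → σ z = τ z)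
    (hxτ : τ x < 0) (hlt : σ x < τ x) : False := by
  have hxB : InB n x := inB_iff.2 (by omega)
  have huB := inB_iff.1 (h'.1.inB_symm_apply.2 (h.1.inB_apply.2 hxB))
  have hu : τ (τ.symm (σ x)) = σ x := Equiv.apply_symm_apply _ _
  generalize τ.symm (σ x) = u at huB hu
  have hne : u ≠ x := by rintro rfl; omega
  rcases huB with huB | huB
  · have hux : u < x := by
      by_contra hcon
      have := h'.apply_lt_apply_of_neg hx (lt_of_le_of_ne (not_lt.1 hcon) hne.symm) huB.2 hxτ
        (by omega)
      omega
    exact hne (σ.injective ((ih u (by omega) hux).trans hu))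
  · have h1 := h'.1.1 u
    have h2 := h.1.1 u
    have h3 := h'.apply_eq_of_apply_pos h hL.symm (x := -u) (by omega) (by omega) (by omega)
    exact hne (σ.injective (by omega))

theorem eq_of_sameLetters (h : IsNCB n σ) (h' : IsNCB n τ) (hL : SameLetters n σ τ) : σ = τ := by
  have key : ∀ d : ℕ, ∀ x : ℤ, 0 < x → x ≤ n → x ≤ d → σ x = τ x := by
    intro d
    induction d with
    | zero => intro x hx _ hd; omega
    | succ d ih =>
      intro x hx hxn hd
      push_cast at hd
      have hxB : InB n x := inB_iff.2 (by omega)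
      have k1 := inB_iff.1 (h.1.inB_apply.2 hxB)
      have k2 := inB_iff.1 (h'.1.inB_apply.2 hxB)
      rcases k1 with k1 | k1
      · exact h.apply_eq_of_apply_pos h' hL hx hxn (by omega)
      rcases k2 with k2 | k2
      · exact (h'.apply_eq_of_apply_pos h hL.symm hx hxn (by omega)).symm
      rcases lt_trichotomy (σ x) (τ x) with hlt | heq | hgt
      · exact (h.not_apply_lt_of_apply_neg h' hL hx hxn
          (fun z hz hzx => ih z hz (by omega) (by omega)) (by omega) hlt).elim
      · exact heq
      · exact (h'.not_apply_lt_of_apply_neg h hL.symm hx hxn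
          (fun z hz hzx => (ih z hz (by omega) (by omega)).symm) (by omega) hgt).elim
  ext x
  by_cases hx : InB n x
  · rcases inB_iff.1 hx with hx' | hx'
    · exact key x.toNat x (by omega) (by omega) (by omega)
    · have h1 := key (-x).toNat (-x) (by omega) (by omega) (by omega)
      rw [h.1.1, h'.1.1] at h1
      omega
  · rw [h.1.2 x hx, h'.1.2 x hx]

end IsNCB

theorem countN_succ {m : ℕ} (w : Fin m → Bool) {k : ℕ} (hk : k < m) :
    countN w (k + 1) = countN w k + if w ⟨k, hk⟩ = true then 1 else 0 := by
  unfold countN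
  have : (Finset.univ.filter (fun t : Fin m => (t : ℕ) < k + 1 ∧ w t = true)) =
      (Finset.univ.filter (fun t : Fin m => (t : ℕ) < k ∧ w t = true)) ∪
        (if w ⟨k, hk⟩ = true then {⟨k, hk⟩} else ∅) := by
    ext t
    have ht : (t : ℕ) = k → t = ⟨k, hk⟩ := fun h => Fin.ext h
    simp only [Finset.mem_union, Finset.mem_filter, Finset.mem_univ, true_and]
    split_ifs with hw
    · simp only [Finset.mem_singleton]
      constructor
      · rintro ⟨h1, h2⟩
        rcases Nat.lt_succ_iff_lt_or_eq.1 h1 with h | h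
        · exact Or.inl ⟨h, h2⟩
        · exact Or.inr (ht h)
      · rintro (⟨h1, h2⟩ | rfl)
        · exact ⟨by omega, h2⟩
        · exact ⟨Nat.lt_succ_self k, hw⟩
    · simp only [Finset.notMem_empty, or_false]
      refine and_congr_left fun h2 => ⟨fun h1 => ?_, fun h1 => by omega⟩
      rcases Nat.lt_succ_iff_lt_or_eq.1 h1 with h | h
      · exact h
      · exact absurd (ht h ▸ h2) hw
  rw [this, Finset.card_union_of_disjoint]
  · split_ifs <;> simp
  · split_ifs <;> simp

theorem countN_zero {m : ℕ} (w : Fin m → Bool) : countN w 0 = 0 := by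
  simp [countN]

theorem countN_add_countE {m : ℕ} (w : Fin m → Bool) {k : ℕ} (hk : k ≤ m) :
    countN w k + countE w k = k := by
  have h := card_filter_fin (n := m) 0 k hk
  rw [← Finset.card_filter_add_card_filter_not (fun t => w t = true)] at h
  simp only [Finset.filter_filter, Nat.zero_le, true_and, Bool.not_eq_true] at h
  exact h

theorem countN_mono {m : ℕ} (w : Fin m → Bool) {k l : ℕ} (h : k ≤ l) :
    countN w k ≤ countN w l :=
  Finset.card_le_card fun t ht => by
    simp only [Finset.mem_filter, Finset.mem_univ, true_and] at ht ⊢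
    exact ⟨by omega, ht.2⟩

theorem countE_mono {m : ℕ} (w : Fin m → Bool) {k l : ℕ} (h : k ≤ l) :
    countE w k ≤ countE w l :=
  Finset.card_le_card fun t ht => by
    simp only [Finset.mem_filter, Finset.mem_univ, true_and] at ht ⊢
    exact ⟨by omega, ht.2⟩

theorem countE_le_countE_length {m : ℕ} (w : Fin m → Bool) (k : ℕ) : countE w k ≤ countE w m :=
  Finset.card_le_card fun t ht => by
    simp only [Finset.mem_filter, Finset.mem_univ, true_and] at ht ⊢
    exact ⟨t.2, ht.2⟩

theorem isDyckB_iff {n : ℕ} {w : Fin (2 * n) → Bool} :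
    IsDyckB n w ↔ ∀ k ≤ 2 * n, k ≤ 2 * countN w k := by
  constructor
  · intro h k hk
    have := h k
    have := countN_add_countE w hk
    omega
  · intro h k
    rcases le_total k (2 * n) with hk | hk
    · have := h k hk
      have := countN_add_countE w hk
      omega
    · have h1 := h (2 * n) le_rfl
      have h2 := countN_add_countE w (le_refl (2 * n))
      have h3 := countN_mono w hk
      have h4 := countE_le_countE_length w k
      omega

/-- The cell `b_{i,j}` is below the path iff the path is above it when crossing its antidiagonal. -/
theorem cellBelow_iff {m : ℕ} (w : Fin m → Bool) {i j : ℕ} (h1 : 1 ≤ i)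
    (h : i + j - 1 ≤ m) : CellBelow w i j ↔ j ≤ countN w (i + j - 1) := by
  have hs := countN_add_countE w h
  constructor
  · rintro ⟨k, hE, hN⟩
    by_contra hcon
    rcases le_total k (i + j - 1) with hk | hk
    · have := countN_mono w hk
      omega
    · have := countE_mono w hk
      omega
  · intro hN
    exact ⟨_, by omega, hN⟩

theorem areaB_eq_sum {n : ℕ} (w : Fin (2 * n) → Bool) :
    areaB n w = ∑ k ∈ Finset.range (2 * n), (countN w (k + 1) - (k + 2) / 2) := by
  set S := (Finset.range (2 * n)).sigma fun k => Finset.Ioc ((k + 2) / 2) (countN w (k + 1))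
    with hS
  have hmem : ∀ q ∈ S, q.1 < 2 * n ∧ (q.1 + 2) / 2 < q.2 ∧ q.2 ≤ countN w (q.1 + 1) ∧
      q.2 ≤ q.1 + 1 := by
    intro q hq
    simp only [hS, Finset.mem_sigma, Finset.mem_range, Finset.mem_Ioc] at hq
    have := countN_add_countE w (k := q.1 + 1) (by omega)
    omega
  have hset : {p : ℕ × ℕ | 1 ≤ p.1 ∧ p.1 < p.2 ∧ p.2 ≤ 2 * n + 1 - p.1 ∧
      CellBelow w p.1 p.2} = (fun q : (_ : ℕ) × ℕ => (q.1 + 2 - q.2, q.2)) '' (S : Set _) := by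
    ext ⟨i, j⟩
    simp only [Set.mem_ofPred_eq, Set.mem_image, Finset.mem_coe, Prod.mk.injEq]
    constructor
    · rintro ⟨h1, h2, h3, h4⟩
      rw [cellBelow_iff w h1 (by omega)] at h4
      refine ⟨⟨i + j - 2, j⟩, ?_, by simp only; omega, rfl⟩
      have : i + j - 2 + 1 = i + j - 1 := by omega
      simp only [hS, Finset.mem_sigma, Finset.mem_range, Finset.mem_Ioc, this]
      omega
    · rintro ⟨q, hq, rfl, rfl⟩
      have hq' := hmem q hq
      have he : q.1 + 2 - q.2 + q.2 - 1 = q.1 + 1 := by omega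
      rw [cellBelow_iff w (by omega) (by omega), he]
      omega
  have hinj : Set.InjOn (fun q : (_ : ℕ) × ℕ => (q.1 + 2 - q.2, q.2)) (S : Set _) := by
    rintro ⟨k, j⟩ hq ⟨k', j'⟩ hq' he
    have h1 := hmem _ hq
    have h2 := hmem _ hq'
    simp only [Prod.mk.injEq] at he h1 h2
    obtain ⟨he, rfl⟩ := he
    have : k = k' := by omega
    rw [this]
  unfold areaB
  rw [hset, hinj.ncard_image, Set.ncard_coe_finset, hS, Finset.card_sigma]
  simp

theorem sum_countN {m : ℕ} (w : Fin m → Bool) :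
    ∑ k ∈ Finset.range m, (countN w (k + 1) : ℤ) =
      ∑ t : Fin m, if w t = true then (m : ℤ) - t else 0 := by
  have : ∀ k, (countN w (k + 1) : ℤ) =
      ∑ t : Fin m, if (t : ℕ) < k + 1 ∧ w t = true then 1 else 0 := by
    intro k
    rw [countN, Finset.natCast_card_filter]
  simp only [this]
  rw [Finset.sum_comm]
  refine Finset.sum_congr rfl fun t _ => ?_
  split_ifs with ht
  · simp only [ht, and_true]
    rw [← Finset.natCast_card_filter]
    have : (Finset.range m).filter (fun k => (t : ℕ) < k + 1) = Finset.Ico (t : ℕ) m := by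
      ext k
      simp only [Finset.mem_filter, Finset.mem_range, Finset.mem_Ico]
      omega
    rw [this, Nat.card_Ico, Nat.cast_sub t.2.le]
  · simp [ht]

theorem sum_range_add_two_div_two (n : ℕ) :
    ∑ k ∈ Finset.range (2 * n), (k + 2) / 2 = n * (n + 1) := by
  induction n with
  | zero => simp
  | succ n ih =>
    rw [show 2 * (n + 1) = 2 * n + 1 + 1 by ring, Finset.sum_range_succ, Finset.sum_range_succ, ih]
    have h1 : (2 * n + 2) / 2 = n + 1 := by omega
    have h2 : (2 * n + 1 + 2) / 2 = n + 1 := by omega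
    rw [h1, h2]
    ring

theorem areaB_eq_of_isDyckB {n : ℕ} {w : Fin (2 * n) → Bool} (hw : IsDyckB n w) :
    (areaB n w : ℤ) =
      (∑ t : Fin (2 * n), if w t = true then (2 * n : ℤ) - t else 0) - n * (n + 1) := by
  have h1 := sum_countN w
  push_cast at h1
  rw [areaB_eq_sum, ← h1, ← Nat.cast_succ, ← Nat.cast_mul, ← sum_range_add_two_div_two n,
    Nat.cast_sum, Nat.cast_sum, ← Finset.sum_sub_distrib]
  refine Finset.sum_congr rfl fun k hk => ?_
  rw [Nat.cast_sub]
  have := isDyckB_iff.1 hw (k + 1) (by simpa using hk)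
  omega

theorem sum_fin_two_mul (n : ℕ) (F : ℕ → ℤ) :
    ∑ t : Fin (2 * n), F t = ∑ i : Fin n, (F (2 * i) + F (2 * i + 1)) := by
  rw [Fin.sum_univ_eq_sum_range, Fin.sum_univ_eq_sum_range (fun i => F (2 * i) + F (2 * i + 1))]
  induction n with
  | zero => simp
  | succ n ih =>
    rw [show 2 * (n + 1) = 2 * n + 1 + 1 by ring, Finset.sum_range_succ, Finset.sum_range_succ, ih,
      Finset.sum_range_succ]
    ring

theorem sum_ncPath (n : ℕ) (σ : Equiv.Perm ℤ) :
    (∑ t : Fin (2 * n), if ncPath n σ t = true then (2 * n : ℤ) - t else 0) =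
      ∑ i : Fin n, ((if σ (i + 1) ≤ i + 1 then 2 * ((i : ℤ) + 1) else 0) +
        if σ.symm (i + 1) < i + 1 then 2 * ((i : ℤ) + 1) - 1 else 0) := by
  set F : ℕ → ℤ := fun t => if (if t % 2 = 0 then decide (σ (n - (t / 2 : ℕ)) ≤ n - (t / 2 : ℕ))
    else decide (σ.symm (n - (t / 2 : ℕ)) < n - (t / 2 : ℕ))) = true then (2 * n : ℤ) - t else 0
    with hF
  change ∑ t : Fin (2 * n), F t = _
  rw [sum_fin_two_mul, ← Equiv.sum_comp Fin.revPerm]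
  refine Finset.sum_congr rfl fun i _ => ?_
  have hi := i.2
  have hr : ((Fin.revPerm i : Fin n) : ℕ) = n - (i + 1) := by simp [Fin.val_rev]
  have h0 : 2 * (n - ((i : ℕ) + 1)) % 2 = 0 := by omega
  have h1 : ¬(2 * (n - ((i : ℕ) + 1)) + 1) % 2 = 0 := by omega
  have h2 : 2 * (n - ((i : ℕ) + 1)) / 2 = n - ((i : ℕ) + 1) := by omega
  have h3 : (2 * (n - ((i : ℕ) + 1)) + 1) / 2 = n - ((i : ℕ) + 1) := by omega
  have h4 : ((n - ((i : ℕ) + 1) : ℕ) : ℤ) = n - (i + 1) := by omega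
  have h5 : (n : ℤ) - (n - (i + 1)) = i + 1 := by ring
  simp only [hF, hr, h0, h1, h2, h3, h4, h5, if_true, if_false, decide_eq_true_eq]
  congr 1
  · congr 1
    push_cast [h4]
    ring
  · congr 1
    push_cast [h4]
    ring

theorem sum_comp_abs {n : ℕ} {σ : Equiv.Perm ℤ} (h : IsSignedPerm n σ) (F : ℤ → ℤ) :
    ∑ x ∈ Finset.Icc (1 : ℤ) n, F |σ x| = ∑ x ∈ Finset.Icc (1 : ℤ) n, F x := by
  have habs : ∀ {y : ℤ}, InB n y → |y| ∈ Finset.Icc (1 : ℤ) n := fun hy => by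
    rw [Finset.mem_Icc]; exact hy
  have hB : ∀ {x : ℤ}, x ∈ Finset.Icc (1 : ℤ) n → InB n x := fun hx => by
    rw [Finset.mem_Icc] at hx
    exact inB_iff.2 (Or.inl hx)
  refine Finset.sum_bij' (fun x _ => |σ x|) (fun x _ => |σ.symm x|)
    (fun x hx => habs (h.inB_apply.2 (hB hx))) (fun x hx => habs (h.inB_symm_apply.2 (hB hx)))
    (fun x hx => ?_) (fun x hx => ?_) (fun x _ => rfl)
  · have hx' := Finset.mem_Icc.1 hx
    rcases abs_choice (σ x) with he | he <;> rw [he]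
    · rw [Equiv.symm_apply_apply, abs_of_pos (by omega)]
    · rw [h.symm_neg, Equiv.symm_apply_apply, abs_neg, abs_of_pos (by omega)]
  · have hx' := Finset.mem_Icc.1 hx
    rcases abs_choice (σ.symm x) with he | he <;> rw [he]
    · rw [Equiv.apply_symm_apply, abs_of_pos (by omega)]
    · rw [h.1, Equiv.apply_symm_apply, abs_neg, abs_of_pos (by omega)]

theorem sum_fin_eq_sum_Icc (n : ℕ) (F : ℤ → ℤ) :
    ∑ i : Fin n, F (i + 1) = ∑ x ∈ Finset.Icc (1 : ℤ) n, F x := by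
  refine Finset.sum_bij' (fun i _ => (i : ℤ) + 1)
    (fun x hx => ⟨(x - 1).toNat, by rw [Finset.mem_Icc] at hx; omega⟩) ?_ ?_ ?_ ?_ ?_
  · intro i _
    have := i.2
    simp only [Finset.mem_Icc]
    omega
  · simp
  · intro i _
    simp
  · intro x hx
    rw [Finset.mem_Icc] at hx
    simp only
    omega
  · simp

theorem sum_fin_comp_abs {n : ℕ} {σ : Equiv.Perm ℤ} (h : IsSignedPerm n σ) (F : ℤ → ℤ) :
    ∑ i : Fin n, F (i + 1) = ∑ i : Fin n, F |word n σ i| := by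
  rw [sum_fin_eq_sum_Icc, ← sum_comp_abs h F, ← sum_fin_eq_sum_Icc n fun x => F |σ x|]
  rfl

theorem sum_fin_succ (n : ℕ) : 2 * ∑ i : Fin n, ((i : ℤ) + 1) = n * (n + 1) := by
  rw [Fin.sum_univ_eq_sum_range (fun i => (i : ℤ) + 1)]
  induction n with
  | zero => simp
  | succ n ih =>
    rw [Finset.sum_range_succ, mul_add, ih]
    push_cast
    ring

theorem areaB_ncPath {n : ℕ} {σ : Equiv.Perm ℤ} (h : IsNCB n σ) (hw : IsDyckB n (ncPath n σ)) :
    (areaB n (ncPath n σ) : ℤ) = lSW (revW (word n σ)) := by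
  have h1 := sum_fin_comp_abs h.1 (fun x => if σ.symm x < x then 2 * x - 1 else 0)
  have h2 := sum_fin_comp_abs h.1 (fun x => x)
  rw [areaB_eq_of_isDyckB hw, sum_ncPath, lSW_revW_word h, Finset.sum_add_distrib, h1,
    ← sum_fin_succ, two_mul, sub_eq_iff_eq_add]
  nth_rw 2 [h2]
  rw [← Finset.sum_add_distrib, ← Finset.sum_add_distrib, ← Finset.sum_add_distrib]
  refine Finset.sum_congr rfl fun i _ => ?_
  have hw' : σ (i + 1) = word n σ i := rfl
  have hs : σ.symm (word n σ i) = i + 1 := Equiv.symm_apply_apply _ _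
  rw [hw']
  rcases word_cases h.1 i with hi | hi
  · rw [abs_of_pos (by omega), hs]
    split_ifs <;> omega
  · rw [abs_of_neg (by omega), h.1.symm_neg, hs]
    split_ifs <;> omega

theorem card_filter_Ioc_sub_succ {n m : ℕ} (p : ℤ → Prop) [DecidablePred p] :
    ((Finset.Ioc ((n : ℤ) - (m + 1 : ℕ)) n).filter p).card =
      ((Finset.Ioc ((n : ℤ) - m) n).filter p).card + if p (n - m) then 1 else 0 := by
  have : Finset.Ioc ((n : ℤ) - (m + 1 : ℕ)) n =
      insert ((n : ℤ) - m) (Finset.Ioc ((n : ℤ) - m) n) := by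
    ext x
    simp only [Finset.mem_Ioc, Finset.mem_insert]
    push_cast
    omega
  rw [this, Finset.filter_insert]
  split_ifs
  · rw [Finset.card_insert_of_notMem (by simp)]
  · rfl

theorem countN_ncPath {n : ℕ} (σ : Equiv.Perm ℤ) {m : ℕ} (hm : m ≤ n) :
    countN (ncPath n σ) (2 * m) =
      ((Finset.Ioc ((n : ℤ) - m) n).filter fun x => σ x ≤ x).card +
        ((Finset.Ioc ((n : ℤ) - m) n).filter fun x => σ.symm x < x).card := by
  induction m with
  | zero => simp [countN_zero]
  | succ m ih =>
    rw [show 2 * (m + 1) = 2 * m + 1 + 1 by ring, countN_succ _ (by omega : 2 * m + 1 < 2 * n),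
      countN_succ _ (by omega : 2 * m < 2 * n), ih (by omega), ncPath_even, ncPath_odd,
      card_filter_Ioc_sub_succ, card_filter_Ioc_sub_succ]
    simp only [decide_eq_true_eq]
    ring

namespace IsNCB

variable {n : ℕ} {σ : Equiv.Perm ℤ}

theorem exists_arc_over (h : IsNCB n σ) {c : ℤ} (hc : 0 < c) (hσ : c < σ c) :
    ∃ y, c < y ∧ y ≤ n ∧ σ y ≤ c := by
  have hcB : InB n c := by
    by_contra hcon
    have := h.1.2 c hcon
    omega
  obtain ⟨y, hy, hmax⟩ := Set.exists_max_image {y | σ.SameCycle c y} (bKey n)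
    ((finite_setOf_inB n).subset fun y hy => h.1.inB_of_sameCycle hcB hy)
    ⟨c, Equiv.Perm.SameCycle.refl _ _⟩
  simp only [Set.mem_ofPred_eq] at hy hmax
  have hyB := h.1.inB_of_sameCycle hcB hy
  have h1 := hmax _ (sameCycle_self_apply σ c)
  have h2 := hmax _ (hy.trans (sameCycle_self_apply σ y))
  have h3 := h.apply_isMin hyB hy.symm h2
  have k1 := bKey_cases hcB
  have k2 := bKey_cases hyB
  have k3 := bKey_cases (h.1.inB_apply.2 hcB)
  have k4 := bKey_cases (h.1.inB_apply.2 hyB)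
  exact ⟨y, by omega, by omega, by omega⟩

theorem le_card_add_card (h : IsNCB n σ) {m : ℕ} (hm : m ≤ n) {s : Finset ℤ}
    (hs : ∀ y ∈ s, (n : ℤ) - m < y ∧ y ≤ n ∧ σ y ≤ n - m) :
    m + s.card ≤ ((Finset.Ioc ((n : ℤ) - m) n).filter fun x => σ x ≤ x).card +
        ((Finset.Ioc ((n : ℤ) - m) n).filter fun x => σ.symm x < x).card := by
  have h1 := Finset.card_filter_add_card_filter_not (s := Finset.Ioc ((n : ℤ) - m) n)
    (fun x => σ.symm x < x)
  rw [Int.card_Ioc] at h1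
  have h2 : (((Finset.Ioc ((n : ℤ) - m) n).filter fun x => ¬σ.symm x < x).map
      σ.symm.toEmbedding).card + s.card ≤
      ((Finset.Ioc ((n : ℤ) - m) n).filter fun x => σ x ≤ x).card := by
    rw [← Finset.card_union_of_disjoint]
    · refine Finset.card_le_card fun y hy => ?_
      rw [Finset.mem_union, Finset.mem_map] at hy
      simp only [Finset.mem_filter, Finset.mem_Ioc]
      rcases hy with ⟨x, hx, rfl⟩ | hy
      · simp only [Finset.mem_filter, Finset.mem_Ioc, not_lt] at hx
        have := inB_iff.1 (h.1.inB_symm_apply.2 (inB_iff.2 (Or.inl ⟨by omega, hx.1.2⟩)))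
        simp only [Equiv.coe_toEmbedding, Equiv.apply_symm_apply]
        omega
      · have := hs y hy
        omega
    · rw [Finset.disjoint_left]
      intro y hy hy'
      rw [Finset.mem_map] at hy
      obtain ⟨x, hx, rfl⟩ := hy
      simp only [Finset.mem_filter, Finset.mem_Ioc, not_lt] at hx
      have := hs _ hy'
      simp only [Equiv.coe_toEmbedding, Equiv.apply_symm_apply] at this
      omega
  rw [Finset.card_map] at h2
  omega

theorem isDyckB_ncPath (h : IsNCB n σ) : IsDyckB n (ncPath n σ) := by
  rw [isDyckB_iff]
  intro k hk
  obtain ⟨m, rfl | rfl⟩ := Nat.even_or_odd' k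
  · have := h.le_card_add_card (m := m) (by omega) (s := ∅) (by simp)
    rw [countN_ncPath σ (by omega)]
    simp only [Finset.card_empty] at this
    omega
  · rw [countN_succ _ (by omega : 2 * m < 2 * n), countN_ncPath σ (by omega), ncPath_even]
    by_cases hc : σ (n - m) ≤ n - m
    · have := h.le_card_add_card (m := m) (by omega) (s := ∅) (by simp)
      simp only [Finset.card_empty] at this
      simp only [hc, decide_true, if_true]
      omega
    · obtain ⟨y, hy⟩ := h.exists_arc_over (c := (n : ℤ) - m) (by omega) (by omega)
      have := h.le_card_add_card (m := m) (by omega) (s := {y}) (by simpa using hy)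
      simp only [Finset.card_singleton] at this
      omega

end IsNCB

/-- `h` is the height function of a lattice path with `2 * n` steps staying above the diagonal. -/
structure IsHeight (n : ℕ) (h : ℤ → ℤ) : Prop where
  zero : h 0 = 0
  step : ∀ t : ℤ, 0 ≤ t → t < 2 * n → h (t + 1) = h t + 1 ∨ h (t + 1) = h t - 1
  nonneg : ∀ t : ℤ, 0 ≤ t → t ≤ 2 * n → 0 ≤ h t
  parity : ∀ t : ℤ, 0 ≤ t → h t % 2 = t % 2

/-- The points `s` and `t` have the same height and `h` stays above it between them. -/
def Level (h : ℤ → ℤ) (s t : ℤ) : Prop :=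
  h s = h t ∧ ∀ u, (s ≤ u ∧ u ≤ t) ∨ (t ≤ u ∧ u ≤ s) → h s ≤ h u

/-- From time `s` on, `h` stays above its value at `s`. -/
def Visible (n : ℕ) (h : ℤ → ℤ) (s : ℤ) : Prop :=
  ∀ u, s ≤ u → u ≤ 2 * n → h s ≤ h u

/-- The time separating the two letters that `ncPath` attaches to `a`. -/
def mid (n : ℕ) (a : ℤ) : ℤ := 2 * n + 1 - 2 * |a|

/-- The relation on `{±1,…,±n}` whose classes are the orbits of the non-crossing signed
permutation with height function `h`. -/
def PathRel (n : ℕ) (h : ℤ → ℤ) (a b : ℤ) : Prop :=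
  InB n a ∧ InB n b ∧ ((0 < a ↔ 0 < b) → Level h (mid n a) (mid n b)) ∧
    (¬(0 < a ↔ 0 < b) → Visible n h (mid n a) ∧ Visible n h (mid n b) ∧
      h (mid n a) + h (mid n b) = h (2 * n))

theorem mid_neg (n : ℕ) (a : ℤ) : mid n (-a) = mid n a := by
  unfold mid
  rw [abs_neg]

theorem mid_cases {n : ℕ} {a : ℤ} (ha : InB n a) :
    (a < 0 ∧ -(n : ℤ) ≤ a ∧ bKey n a = -a ∧ mid n a = 2 * n + 1 + 2 * a) ∨
      (0 < a ∧ a ≤ n ∧ bKey n a = a + n ∧ mid n a = 2 * n + 1 - 2 * a) := by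
  have := bKey_cases ha
  unfold mid
  rcases abs_cases a with h | h <;> omega

namespace Level

variable {n : ℕ} {h : ℤ → ℤ} {s t u v : ℤ}

theorem refl (h : ℤ → ℤ) (s : ℤ) : Level h s s :=
  ⟨rfl, fun u hu => by rw [show u = s by omega]⟩

theorem symm (hl : Level h s t) : Level h t s :=
  ⟨hl.1.symm, fun u hu => hl.1 ▸ hl.2 u hu.symm⟩

theorem trans (h1 : Level h s t) (h2 : Level h t u) : Level h s u := by
  refine ⟨h1.1.trans h2.1, fun v hv => ?_⟩
  by_cases hst : (s ≤ v ∧ v ≤ t) ∨ (t ≤ v ∧ v ≤ s)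
  · exact h1.2 v hst
  · exact h1.1 ▸ h2.2 v (by omega)

theorem visible (hl : Level h s t) (hs : Visible n h s) : Visible n h t := by
  intro u htu hu
  rw [← hl.1]
  by_cases hsu : s ≤ u
  · exact hs u hsu hu
  · exact hl.2 u (by omega)

theorem of_visible (hs : Visible n h s) (ht : Visible n h t) (hst : h s = h t) (hsn : s ≤ 2 * n)
    (htn : t ≤ 2 * n) : Level h s t := by
  refine ⟨hst, fun u hu => ?_⟩
  rcases hu with hu | hu
  · exact hs u hu.1 (by omega)
  · exact hst ▸ ht u hu.1 (by omega)

theorem of_le (hl : Level h s u) (hut : u ≤ t) (hts : t ≤ s) (hle : h t ≤ h s) : Level h s t := by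
  have := hl.2 t (by omega)
  exact ⟨by omega, fun v hv => hl.2 v (by omega)⟩

theorem of_crossing (h1 : Level h s u) (h2 : Level h t v) (hvu : v ≤ u) (hut : u ≤ t)
    (hts : t ≤ s) : Level h s t := by
  refine h1.of_le hut hts ?_
  rw [h1.1]
  exact h2.2 u (by omega)

end Level

namespace PathRel

variable {n : ℕ} {h : ℤ → ℤ} {a b c d : ℤ}

theorem refl (h : ℤ → ℤ) (ha : InB n a) : PathRel n h a a :=
  ⟨ha, ha, fun _ => Level.refl _ _, fun hcon => absurd Iff.rfl hcon⟩

theorem symm (hab : PathRel n h a b) : PathRel n h b a :=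
  ⟨hab.2.1, hab.1, fun hs => (hab.2.2.1 hs.symm).symm, fun hs => by
    obtain ⟨h1, h2, h3⟩ := hab.2.2.2 fun e => hs e.symm
    exact ⟨h2, h1, by omega⟩⟩

theorem neg (hab : PathRel n h a b) : PathRel n h (-a) (-b) := by
  obtain ⟨ha, hb, h1, h2⟩ := hab
  have ka := mid_cases ha
  have kb := mid_cases hb
  refine ⟨inB_neg.2 ha, inB_neg.2 hb, fun hs => ?_, fun hs => ?_⟩
  · rw [mid_neg, mid_neg]
    exact h1 (by omega)
  · rw [mid_neg, mid_neg]
    exact h2 (by omega)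

theorem trans (hab : PathRel n h a b) (hbc : PathRel n h b c) : PathRel n h a c := by
  obtain ⟨ha, hb, h1, h2⟩ := hab
  obtain ⟨-, hc, h3, h4⟩ := hbc
  have ka := mid_cases ha
  have kc := mid_cases hc
  refine ⟨ha, hc, fun hs => ?_, fun hs => ?_⟩
  · by_cases hs' : 0 < a ↔ 0 < b
    · exact (h1 hs').trans (h3 (hs'.symm.trans hs))
    · obtain ⟨v1, v2, e1⟩ := h2 hs'
      obtain ⟨v3, v4, e2⟩ := h4 fun e => hs' (hs.trans e.symm)
      exact Level.of_visible v1 v4 (by omega) (by omega) (by omega)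
  · by_cases hs' : 0 < a ↔ 0 < b
    · obtain ⟨v3, v4, e2⟩ := h4 fun e => hs (hs'.trans e)
      have := h1 hs'
      exact ⟨this.symm.visible v3, v4, by rw [this.1]; exact e2⟩
    · obtain ⟨v1, v2, e1⟩ := h2 hs'
      have := h3 (by tauto)
      exact ⟨v1, this.visible v2, by rw [← this.1]; exact e1⟩

theorem of_crossing (hac : PathRel n h a c) (hbd : PathRel n h b d)
    (h1 : bKey n a < bKey n b) (h2 : bKey n b < bKey n c) (h3 : bKey n c < bKey n d) :
    PathRel n h a b := by
  obtain ⟨ha, hc, hl, hv⟩ := hac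
  obtain ⟨hb, hd, hl', hv'⟩ := hbd
  have ka := mid_cases ha
  have kb := mid_cases hb
  have kc := mid_cases hc
  have kd := mid_cases hd
  by_cases hs : 0 < a ↔ 0 < b
  · refine ⟨ha, hb, fun _ => ?_, fun hcon => absurd hs hcon⟩
    by_cases hs1 : 0 < a ↔ 0 < c
    · by_cases hs2 : 0 < b ↔ 0 < d
      · exact (hl hs1).of_crossing (hl' hs2) (by omega) (by omega) (by omega)
      · exact (hl hs1).of_le (by omega) (by omega) ((hv' hs2).1 _ (by omega) (by omega))
    · obtain ⟨v1, v2, e1⟩ := hv hs1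
      obtain ⟨v3, v4, e2⟩ := hv' (by omega)
      have := v3 (mid n a) (by omega) (by omega)
      have := v4 (mid n c) (by omega) (by omega)
      exact Level.of_visible v1 v3 (by omega) (by omega) (by omega)
  · refine ⟨ha, hb, fun hcon => absurd hcon hs, fun _ => ?_⟩
    obtain ⟨v1, v2, e1⟩ := hv (by omega)
    have hbc : Level h (mid n b) (mid n c) :=
      (hl' (by omega)).of_le (by omega) (by omega) (v2 _ (by omega) (by omega))
    exact ⟨v1, hbc.symm.visible v2, by rw [hbc.1]; exact e1⟩

theorem of_neg_self (haa : PathRel n h a (-a)) (hbb : PathRel n h b (-b)) : PathRel n h a b := by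
  obtain ⟨ha, -, -, h2⟩ := haa
  obtain ⟨hb, -, -, h4⟩ := hbb
  have ka := mid_cases ha
  have kb := mid_cases hb
  rw [mid_neg] at h2 h4
  obtain ⟨v1, -, e1⟩ := h2 (by omega)
  obtain ⟨v2, -, e2⟩ := h4 (by omega)
  exact ⟨ha, hb, fun _ => Level.of_visible v1 v2 (by omega) (by omega) (by omega),
    fun _ => ⟨v1, v2, by omega⟩⟩

theorem exists_isNCB (n : ℕ) (h : ℤ → ℤ) :
    ∃ σ, IsNCB n σ ∧ ∀ x y, InB n x → (σ.SameCycle x y ↔ PathRel n h x y) := by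
  obtain ⟨σ, h1, h2, h3⟩ := exists_perm_of_rel n (PathRel n h) (fun x y hxy => ⟨hxy.1, hxy.2.1⟩)
    (fun x hx => refl h hx) (fun x y => symm) (fun x y z => trans) (fun x y => neg)
  refine ⟨σ, ⟨h1, h2, ?_, ?_⟩, h3⟩
  · rintro ⟨a, b, c, d, ha, hb, hc, hd, k1, k2, k3, hac, hbd, hab⟩
    rw [h3 _ _ ha] at hac hab
    rw [h3 _ _ hb] at hbd
    exact hab (hac.of_crossing hbd k1 k2 k3)
  · intro x y hx hy hxx hyy
    rw [h3 _ _ hx] at hxx ⊢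
    rw [h3 _ _ hy] at hyy
    exact hxx.of_neg_self hyy

end PathRel

namespace IsHeight

variable {n : ℕ} {h : ℤ → ℤ} {s e x l : ℤ}

theorem exists_last (H : IsHeight n h) (hs : 0 ≤ s) (hsn : s ≤ 2 * n) (hl : 0 ≤ l)
    (hls : l < h s) : ∃ t, 0 ≤ t ∧ t < s ∧ h t = l ∧ ∀ u, t < u → u ≤ s → l < h u := by
  obtain ⟨t, ⟨h0, hts, hle⟩, hmax⟩ := Int.exists_greatest_of_bdd
    (P := fun t => 0 ≤ t ∧ t ≤ s ∧ h t ≤ l) ⟨s, fun z hz => hz.2.1⟩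
    ⟨0, le_rfl, hs, by rw [H.zero]; exact hl⟩
  have hne : t ≠ s := by rintro rfl; omega
  have hgt : ∀ u, t < u → u ≤ s → l < h u := fun u htu hus => by
    by_contra hcon
    have := hmax u ⟨by omega, hus, by omega⟩
    omega
  have h1 := hgt (t + 1) (by omega) (by omega)
  have h2 := H.step t h0 (by omega)
  exact ⟨t, h0, by omega, by omega, hgt⟩

theorem exists_first (H : IsHeight n h) (hs : 0 ≤ s) (hse : s ≤ e) (hen : e ≤ 2 * n)
    (hls : l < h s) (hle : h e ≤ l) :
    ∃ t, s < t ∧ t ≤ e ∧ h t = l ∧ ∀ u, s ≤ u → u < t → l < h u := by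
  obtain ⟨t, ⟨hst, hte, hlt⟩, hmin⟩ := Int.exists_least_of_bdd
    (P := fun t => s ≤ t ∧ t ≤ e ∧ h t ≤ l) ⟨s, fun z hz => hz.1⟩ ⟨e, hse, le_rfl, hle⟩
  have hne : t ≠ s := by rintro rfl; omega
  have hgt : ∀ u, s ≤ u → u < t → l < h u := fun u hsu hut => by
    by_contra hcon
    have := hmin u ⟨hsu, by omega, by omega⟩
    omega
  have h1 := hgt (t - 1) (by omega) (by omega)
  have h2 := H.step (t - 1) (by omega) (by omega)
  rw [sub_add_cancel] at h2
  exact ⟨t, by omega, hte, by omega, hgt⟩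

theorem exists_pathRel_gt_iff (H : IsHeight n h) (hx : 0 < x) (hxn : x ≤ n) :
    (∃ y, PathRel n h x y ∧ bKey n x < bKey n y) ↔ h (mid n x - 1) = h (mid n x) + 1 := by
  have hxB : InB n x := inB_iff.2 (by omega)
  have kx := mid_cases hxB
  constructor
  · rintro ⟨y, ⟨-, hyB, hl, -⟩, hxy⟩
    have ky := mid_cases hyB
    have h1 := (hl (by omega)).2 (mid n x - 1) (by omega)
    have h2 := H.step (mid n x - 1) (by omega) (by omega)
    rw [sub_add_cancel] at h2
    omega
  · intro hE
    have p1 := H.parity (mid n x) (by omega)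
    have p2 := H.nonneg (mid n x) (by omega) (by omega)
    obtain ⟨t, h0, ht, hl, hgt⟩ := H.exists_last (s := mid n x - 1) (l := h (mid n x))
      (by omega) (by omega) (by omega) (by omega)
    have p3 := H.parity t h0
    obtain ⟨y, rfl⟩ : ∃ y : ℤ, t = 2 * n + 1 - 2 * y := ⟨(2 * n + 1 - t) / 2, by omega⟩
    have hyB : InB n y := inB_iff.2 (by omega)
    have ky := mid_cases hyB
    have hm : mid n y = 2 * n + 1 - 2 * y := by omega
    rw [← hm] at hl hgt ht
    refine ⟨y, ⟨hxB, hyB, fun _ => ⟨hl.symm, fun u hu => ?_⟩, fun hcon => by omega⟩, by omega⟩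
    rcases eq_or_ne u (mid n x) with rfl | h1
    · exact le_rfl
    rcases eq_or_ne u (mid n y) with rfl | h2
    · exact hl.ge
    · exact (hgt u (by omega) (by omega)).le

theorem exists_pathRel_lt_iff (H : IsHeight n h) (hx : 0 < x) (hxn : x ≤ n) :
    (∃ y, PathRel n h x y ∧ bKey n y < bKey n x) ↔ h (mid n x + 1) = h (mid n x) + 1 := by
  have hxB : InB n x := inB_iff.2 (by omega)
  have kx := mid_cases hxB
  constructor
  · rintro ⟨y, ⟨-, hyB, hl, hv⟩, hxy⟩
    have ky := mid_cases hyB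
    have h2 := H.step (mid n x) (by omega) (by omega)
    by_cases hs : 0 < x ↔ 0 < y
    · have h1 := (hl hs).2 (mid n x + 1) (by omega)
      omega
    · have h1 := (hv hs).1 (mid n x + 1) (by omega) (by omega)
      omega
  · intro hN
    have p1 := H.parity (mid n x) (by omega)
    have p2 := H.nonneg (mid n x) (by omega) (by omega)
    by_cases hvis : Visible n h (mid n x)
    · have p4 := H.parity (2 * n) (by omega)
      have p5 := hvis (2 * n) (by omega) le_rfl
      obtain ⟨t, h0, ht, hl, hgt⟩ := H.exists_last (s := 2 * n) (l := h (2 * n) - h (mid n x))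
        (by omega) (by omega) (by omega) (by omega)
      have p3 := H.parity t h0
      obtain ⟨y, rfl⟩ : ∃ y : ℤ, t = 2 * n + 1 + 2 * y := ⟨-((2 * n + 1 - t) / 2), by omega⟩
      have hyB : InB n y := inB_iff.2 (by omega)
      have ky := mid_cases hyB
      have hm : mid n y = 2 * n + 1 + 2 * y := by omega
      rw [← hm] at hl hgt ht
      refine ⟨y, ⟨hxB, hyB, fun hcon => by omega, fun _ => ⟨hvis, fun u hu hun => ?_, by omega⟩⟩,
        by omega⟩
      rcases eq_or_ne u (mid n y) with rfl | h2
      · exact le_rfl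
      · rw [hl]
        exact (hgt u (by omega) hun).le
    · unfold Visible at hvis
      push Not at hvis
      obtain ⟨e, he, hen, hlt⟩ := hvis
      have hne : e ≠ mid n x := by rintro rfl; omega
      obtain ⟨t, h0, ht, hl, hgt⟩ := H.exists_first (s := mid n x + 1) (e := e)
        (l := h (mid n x)) (by omega) (by omega) hen (by omega) hlt.le
      have p3 := H.parity t (by omega)
      obtain ⟨y, rfl⟩ : ∃ y : ℤ, t = 2 * n + 1 - 2 * y := ⟨(2 * n + 1 - t) / 2, by omega⟩
      have hyB : InB n y := inB_iff.2 (by omega)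
      have ky := mid_cases hyB
      have hm : mid n y = 2 * n + 1 - 2 * y := by omega
      rw [← hm] at hl hgt ht
      refine ⟨y, ⟨hxB, hyB, fun _ => ⟨hl.symm, fun u hu => ?_⟩, fun hcon => by omega⟩, by omega⟩
      rcases eq_or_ne u (mid n x) with rfl | h1
      · exact le_rfl
      rcases eq_or_ne u (mid n y) with rfl | h2
      · exact hl.ge
      · exact (hgt u (by omega) (by omega)).le

end IsHeight

/-- The height of the path `w` after `t` steps. -/
noncomputable def height {m : ℕ} (w : Fin m → Bool) (t : ℤ) : ℤ := 2 * countN w t.toNat - t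

theorem height_succ {m : ℕ} (w : Fin m → Bool) {k : ℕ} (hk : k < m) :
    height w (k + 1) = height w k + if w ⟨k, hk⟩ = true then 1 else -1 := by
  unfold height
  rw [Int.toNat_natCast_add_one, Int.toNat_natCast, countN_succ w hk]
  push_cast
  split_ifs <;> ring

theorem IsDyckB.isHeight {n : ℕ} {w : Fin (2 * n) → Bool} (hw : IsDyckB n w) :
    IsHeight n (height w) where
  zero := by simp [height, countN_zero]
  step t h0 ht := by
    lift t to ℕ using h0
    rw [height_succ w (by omega)]
    split_ifs <;> omega
  nonneg t h0 ht := by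
    lift t to ℕ using h0
    have := isDyckB_iff.1 hw t (by omega)
    simp only [height, Int.toNat_natCast]
    omega
  parity t h0 := by
    unfold height
    omega

theorem IsDyckB.exists_ncPath_eq {n : ℕ} {w : Fin (2 * n) → Bool} (hw : IsDyckB n w) :
    ∃ σ, IsNCB n σ ∧ ncPath n σ = w := by
  obtain ⟨σ, hσ, hrel⟩ := PathRel.exists_isNCB n (height w)
  refine ⟨σ, hσ, funext fun ⟨t, ht⟩ => ?_⟩
  have H := hw.isHeight
  obtain ⟨m, hm⟩ := Nat.even_or_odd' t
  have hxB : InB n ((n : ℤ) - m) := inB_iff.2 (by omega)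
  have kx := mid_cases hxB
  have hmid : mid n ((n : ℤ) - m) = 2 * m + 1 := by omega
  rcases hm with rfl | rfl
  · have h3 : (∃ y, PathRel n (height w) (n - m) y ∧ bKey n (n - m) < bKey n y) ↔
        ¬σ (n - m) ≤ n - m := by
      have k2 := bKey_cases (hσ.1.inB_apply.2 hxB)
      constructor
      · rintro ⟨y, hy, hlt⟩ hle
        have := hσ.isMax hxB ((hrel _ _ hxB).2 hy) (by omega)
        omega
      · intro hlt
        exact ⟨_, (hrel _ _ hxB).1 (sameCycle_self_apply σ _), by omega⟩
    have h1 := H.exists_pathRel_gt_iff (x := n - m) (by omega) (by omega)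
    have h2 := height_succ w ht
    push_cast at h2
    rw [hmid, add_sub_cancel_right, h2] at h1
    rw [ncPath_even, Bool.eq_iff_iff, decide_eq_true_iff, ← not_iff_not, ← h3, h1]
    by_cases hc : w ⟨2 * m, ht⟩ = true
    · rw [if_pos hc]
      exact iff_of_false (by omega) (not_not.2 hc)
    · rw [if_neg hc]
      exact iff_of_true (by omega) hc
  · have h3 : (∃ y, PathRel n (height w) (n - m) y ∧ bKey n y < bKey n (n - m)) ↔
        σ.symm (n - m) < n - m := by
      have k2 := bKey_cases (hσ.1.inB_symm_apply.2 hxB)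
      constructor
      · rintro ⟨y, hy, hlt⟩
        by_contra hcon
        have := hσ.isMin (y := y) hxB ((hrel _ _ hxB).2 hy) (by omega)
        omega
      · intro hlt
        refine ⟨σ.symm (n - m), (hrel _ _ hxB).1 ?_, by omega⟩
        simpa using (sameCycle_self_apply σ (σ.symm (n - m))).symm
    have h1 := H.exists_pathRel_lt_iff (x := n - m) (by omega) (by omega)
    have h2 := height_succ w ht
    push_cast at h2
    rw [hmid, h2] at h1
    rw [ncPath_odd, Bool.eq_iff_iff, decide_eq_true_iff, ← h3, h1]
    by_cases hc : w ⟨2 * m + 1, ht⟩ = true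
    · rw [if_pos hc]
      exact iff_of_true rfl hc
    · rw [if_neg hc]
      exact iff_of_false (by omega) hc

/-- For every `n ≥ 1` and every integer `k`, type `B_n` Dyck paths of area `k`
are equinumerous with non-crossing signed permutations `σ ∈ NC(B_n)` such that
the Coxeter length of `rev(σ)` is `k`. -/
theorem areaB_eq_lS_rev_NCB (n : ℕ) (hn : 1 ≤ n) (k : ℤ) :
    {w : Fin (2 * n) → Bool | IsDyckB n w ∧ (areaB n w : ℤ) = k}.ncard =
      {σ : Equiv.Perm ℤ | IsNCB n σ ∧ lSW (revW (word n σ)) = k}.ncard := by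
  rw [← Set.InjOn.ncard_image (f := ncPath n)]
  · congr 1
    ext w
    simp only [Set.mem_ofPred_eq, Set.mem_image]
    constructor
    · rintro ⟨hw, hk⟩
      obtain ⟨σ, hσ, rfl⟩ := hw.exists_ncPath_eq
      exact ⟨σ, ⟨hσ, by rw [← areaB_ncPath hσ hw, hk]⟩, rfl⟩
    · rintro ⟨σ, ⟨hσ, hk⟩, rfl⟩
      exact ⟨hσ.isDyckB_ncPath, by rw [areaB_ncPath hσ hσ.isDyckB_ncPath, hk]⟩
  · rintro σ ⟨hσ, -⟩ τ ⟨hτ, -⟩ he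
    exact hσ.eq_of_sameLetters hτ (sameLetters_of_ncPath_eq he)

end Stmt
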